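/- For every t > 0, the map t ↦ ⟨q_{12}q̃_{12}⟩_t is differentiable and d/dt ⟨q_{12}q̃_{12}⟩_t = ⟨ q_{12}²q̃_{12}² − 4 q_{12}q̃_{12}q_{23}q̃_{23} + 3 q_{12}q̃_{12}q_{34}q̃_{34} ⟩_t. -/

import Mathlib

open MeasureTheory ProbabilityTheory Filter

noncomputable section

/-- spin value of a Boolean configuration coordinate: `±1`. -/
def spinval (b : Bool) : ℝ := if b then 1 else -1

/-- Joint law of the two independent i.i.d. standard Gaussian families `(Ĵ, J̃)`. -/
def couplingLaw (N M : ℕ) :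
    Measure (((Fin M × Fin M) → ℝ) × ((Fin N × Fin M) → ℝ)) :=
  (Measure.pi fun _ : Fin M × Fin M => gaussianReal 0 1).prod
    (Measure.pi fun _ : Fin N × Fin M => gaussianReal 0 1)

/-- Random Gibbs weight on a pair `(σ, τ)`:
`ξ_τ · exp(√(t/(NM)) Σ_{i,k} J̃_{ik} τ_k σ_i)` with
`ξ_τ = exp((β/√M) Σ_{k,l} Ĵ_{kl} τ_k τ_l)`. -/
def cavityWeight (N M : ℕ) (β t : ℝ)
    (J : ((Fin M × Fin M) → ℝ) × ((Fin N × Fin M) → ℝ))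
    (στ : (Fin N → Bool) × (Fin M → Bool)) : ℝ :=
  Real.exp ((β / Real.sqrt M) * ∑ k : Fin M, ∑ l : Fin M,
      J.1 (k, l) * spinval (στ.2 k) * spinval (στ.2 l)
    + Real.sqrt (t / ((N : ℝ) * (M : ℝ))) * ∑ i : Fin N, ∑ k : Fin M,
      J.2 (i, k) * spinval (στ.2 k) * spinval (στ.1 i))

/-- Partition function of the cavity Gibbs measure. -/
def cavityZ (N M : ℕ) (β t : ℝ)
    (J : ((Fin M × Fin M) → ℝ) × ((Fin N × Fin M) → ℝ)) : ℝ :=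
  ∑ στ : (Fin N → Bool) × (Fin M → Bool), cavityWeight N M β t J στ

/-- Quenched replicated Gibbs average `⟨f⟩_t = E[Ω_t(f)]` over `n` replicas. -/
def replicaAvg (n N M : ℕ) (β t : ℝ)
    (f : (Fin n → (Fin N → Bool) × (Fin M → Bool)) → ℝ) : ℝ :=
  ∫ J, (∑ R : Fin n → (Fin N → Bool) × (Fin M → Bool),
      (∏ a : Fin n, cavityWeight N M β t J (R a)) * f R) / (cavityZ N M β t J) ^ n
    ∂(couplingLaw N M)

/-- Overlap `(1/N) Σ_i σ_i σ'_i` of two spin configurations. -/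
def ovlp (N : ℕ) (σ σ' : Fin N → Bool) : ℝ :=
  (1 / (N : ℝ)) * ∑ i : Fin N, spinval (σ i) * spinval (σ' i)

section GaussianIntegrationByParts

/-- Stein's lemma for the standard Gaussian and a bounded function with bounded derivative. -/
theorem integral_id_mul_gaussianReal {f f' : ℝ → ℝ} {C C' : ℝ}
    (hf : ∀ x, HasDerivAt f (f' x) x) (hf' : Measurable f')
    (hC : ∀ x, |f x| ≤ C) (hC' : ∀ x, |f' x| ≤ C') :
    ∫ x, x * f x ∂gaussianReal 0 1 = ∫ x, f' x ∂gaussianReal 0 1 := by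
  have hfm : Measurable f :=
    (continuous_iff_continuousAt.2 fun x => (hf x).continuousAt).measurable
  have hpdf : ∀ x, gaussianPDFReal 0 1 x
      = (Real.sqrt (2 * Real.pi))⁻¹ * Real.exp (-(1 / 2 : ℝ) * x ^ 2) := by
    intro x
    simp only [gaussianPDFReal_def, NNReal.coe_one, mul_one, sub_zero]
    congr 2
    ring
  have hder : ∀ x, HasDerivAt (gaussianPDFReal 0 1) (-(x * gaussianPDFReal 0 1 x)) x := by
    intro x
    have h1 : HasDerivAt (fun y : ℝ => -(1 / 2 : ℝ) * y ^ 2) (-x) x := by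
      refine (((hasDerivAt_id x).pow 2).const_mul (-(1 / 2 : ℝ))).congr_deriv ?_
      simp
    rw [funext hpdf]
    refine (h1.exp.const_mul _).congr_deriv ?_
    ring
  have hint : Integrable (gaussianPDFReal 0 1) := integrable_gaussianPDFReal 0 1
  have hxint : Integrable (fun x => x * gaussianPDFReal 0 1 x) := by
    refine ((integrable_mul_exp_neg_mul_sq (b := 1 / 2) (by norm_num)).const_mul
      (Real.sqrt (2 * Real.pi))⁻¹).congr (Eventually.of_forall fun x => ?_)
    simp only [hpdf]
    ring
  have key := integral_mul_deriv_eq_deriv_mul_of_integrable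
    (u := f) (v := gaussianPDFReal 0 1) (fun x _ => hf x) (fun x _ => hder x)
    (hxint.neg.bdd_mul hfm.aestronglyMeasurable (Eventually.of_forall hC))
    (hint.bdd_mul hf'.aestronglyMeasurable (Eventually.of_forall hC'))
    (hint.bdd_mul hfm.aestronglyMeasurable (Eventually.of_forall hC))
  rw [integral_gaussianReal_eq_integral_smul one_ne_zero,
    integral_gaussianReal_eq_integral_smul one_ne_zero]
  simp only [smul_eq_mul]
  have e1 : ∀ x, gaussianPDFReal 0 1 x * (x * f x) = -(f x * -(x * gaussianPDFReal 0 1 x)) := by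
    intro x; ring
  simp_rw [e1, integral_neg, key, neg_neg, mul_comm]

/-- Resampling one coordinate preserves a product probability measure. -/
theorem measurePreserving_update_pi {ι : Type*} [Fintype ι] [DecidableEq ι] (γ : Measure ℝ)
    [IsProbabilityMeasure γ] (i : ι) :
    MeasurePreserving (fun p : (ι → ℝ) × ℝ => Function.update p.1 i p.2)
      ((Measure.pi fun _ : ι => γ).prod γ) (Measure.pi fun _ : ι => γ) := by
  have hm : Measurable (fun p : (ι → ℝ) × ℝ => Function.update p.1 i p.2) := by
    refine measurable_pi_iff.2 fun j => ?_
    by_cases h : j = i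
    · subst h; simpa using measurable_snd
    · simpa [Function.update_of_ne h, Function.comp_def] using
        (measurable_pi_apply j).comp (measurable_fst (α := ι → ℝ) (β := ℝ))
  refine ⟨hm, (Measure.pi_eq fun s hs => ?_).symm⟩
  have hpre : (fun p : (ι → ℝ) × ℝ => Function.update p.1 i p.2) ⁻¹' (Set.univ.pi s)
      = (Set.univ.pi (Function.update s i Set.univ)) ×ˢ s i := by
    ext ⟨x, y⟩
    simp only [Set.mem_preimage, Set.mem_pi, Set.mem_univ, true_imp_iff, Set.mem_prod]
    constructor
    · refine fun h => ⟨fun j => ?_, by simpa using h i⟩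
      by_cases hj : j = i
      · subst hj; simp
      · simpa [hj] using h j
    · rintro ⟨h, hy⟩ j
      by_cases hj : j = i
      · subst hj; simpa using hy
      · simpa [hj] using h j
  rw [Measure.map_apply hm (MeasurableSet.univ_pi hs), hpre, Measure.prod_prod, Measure.pi_pi,
    ← Finset.mul_prod_erase Finset.univ _ (Finset.mem_univ i),
    ← Finset.mul_prod_erase Finset.univ (fun j => γ (s j)) (Finset.mem_univ i)]
  have : ∏ j ∈ Finset.univ.erase i, γ (Function.update s i Set.univ j)
      = ∏ j ∈ Finset.univ.erase i, γ (s j) :=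
    Finset.prod_congr rfl fun j hj => by rw [Function.update_of_ne (Finset.ne_of_mem_erase hj)]
  simp [this, mul_comm]

theorem integrable_abs_eval_pi_gaussianReal {ι : Type*} [Fintype ι] (i : ι) :
    Integrable (fun x : ι → ℝ => |x i|) (Measure.pi fun _ : ι => gaussianReal 0 1) := by
  have h : Integrable (fun y : ℝ => |y|) (gaussianReal 0 1) :=
    ((memLp_id_gaussianReal 1).integrable (by simp)).abs
  exact (measurePreserving_eval (fun _ : ι => gaussianReal 0 1) i).integrable_comp_of_integrable h

/-- Gaussian integration by parts in one coordinate of an i.i.d. standard Gaussian family. -/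
theorem integral_eval_mul_pi_gaussianReal {ι : Type*} [Fintype ι] [DecidableEq ι]
    {f f' : (ι → ℝ) → ℝ} {C C' : ℝ} (i : ι)
    (hfm : Measurable f) (hfm' : Measurable f')
    (hf : ∀ x y, HasDerivAt (fun y => f (Function.update x i y)) (f' (Function.update x i y)) y)
    (hC : ∀ x, |f x| ≤ C) (hC' : ∀ x, |f' x| ≤ C') :
    ∫ x, x i * f x ∂(Measure.pi fun _ : ι => gaussianReal 0 1)
      = ∫ x, f' x ∂(Measure.pi fun _ : ι => gaussianReal 0 1) := by
  have hmp := measurePreserving_update_pi (gaussianReal 0 1) i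
  have hi : Integrable (fun x : ι → ℝ => x i * f x) (Measure.pi fun _ : ι => gaussianReal 0 1) := by
    refine ((integrable_abs_eval_pi_gaussianReal i).mul_const C).mono'
      ((measurable_pi_apply i).mul hfm).aestronglyMeasurable (Eventually.of_forall fun x => ?_)
    rw [Real.norm_eq_abs, abs_mul]
    exact mul_le_mul_of_nonneg_left (hC x) (abs_nonneg _)
  have hi' : Integrable f' (Measure.pi fun _ : ι => gaussianReal 0 1) :=
    Integrable.of_bound hfm'.aestronglyMeasurable C' (Eventually.of_forall hC')
  have resample : ∀ {F : (ι → ℝ) → ℝ}, Integrable F (Measure.pi fun _ : ι => gaussianReal 0 1) →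
      ∫ x, F x ∂(Measure.pi fun _ : ι => gaussianReal 0 1)
        = ∫ x, ∫ y, F (Function.update x i y) ∂gaussianReal 0 1
          ∂(Measure.pi fun _ : ι => gaussianReal 0 1) := by
    intro F hF
    rw [← integral_prod (fun p : (ι → ℝ) × ℝ => F (Function.update p.1 i p.2))
      (hmp.integrable_comp_of_integrable hF), ← integral_map hmp.measurable.aemeasurable
      (by rw [hmp.map_eq]; exact hF.aestronglyMeasurable), hmp.map_eq]
  rw [resample hi, resample hi']
  refine integral_congr_ae (Eventually.of_forall fun x => ?_)
  simp only [Function.update_self]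
  exact integral_id_mul_gaussianReal (hf x) (hfm'.comp (measurable_update x)) (fun y => hC _)
    (fun y => hC' _)

end GaussianIntegrationByParts

section ReplicaMean

/-- The observable, with one fresh replica, that represents the derivative of the `n`-replica
average of `f` when the log-weights move in direction `d`. -/
def replicaGrad {S : Type*} (n : ℕ) (d : S → ℝ) (f : (Fin n → S) → ℝ) (R : Fin (n + 1) → S) : ℝ :=
  f (fun a => R a.castSucc) * (∑ a : Fin n, d (R a.castSucc) - n * d (R (Fin.last n)))

theorem replicaGrad_sum {S ι : Type*} [Fintype ι] (n : ℕ) (x : ι → ℝ) (v : S → ι → ℝ)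
    (f : (Fin n → S) → ℝ) :
    replicaGrad n (fun s => ∑ i, x i * v s i) f
      = fun R => ∑ i, x i * replicaGrad n (fun s => v s i) f R := by
  ext R
  simp only [replicaGrad, mul_sub, Finset.sum_sub_distrib, Finset.mul_sum]
  rw [Finset.sum_comm]
  congr 1
  · exact Finset.sum_congr rfl fun a _ => Finset.sum_congr rfl fun i _ => by ring
  · exact Finset.sum_congr rfl fun i _ => by ring

theorem replicaGrad_const_mul {S : Type*} (n : ℕ) (c : ℝ) (d : S → ℝ) (f : (Fin n → S) → ℝ) :
    replicaGrad n (fun s => c * d s) f = fun R => c * replicaGrad n d f R := by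
  ext R
  simp only [replicaGrad, ← Finset.mul_sum]
  ring

variable {S : Type*} [Fintype S]

/-- Gibbs probabilities with log-weights `g`. -/
def gibbsProb (g : S → ℝ) (s : S) : ℝ := Real.exp (g s) / ∑ r, Real.exp (g r)

/-- Average of `f` over `n` independent replicas of the Gibbs measure with log-weights `g`. -/
def replicaMean (n : ℕ) (g : S → ℝ) (f : (Fin n → S) → ℝ) : ℝ :=
  ∑ R : Fin n → S, (∏ a, gibbsProb g (R a)) * f R

theorem gibbsProb_nonneg (g : S → ℝ) (s : S) : 0 ≤ gibbsProb g s := by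
  unfold gibbsProb; positivity

theorem gibbsProb_le_one (g : S → ℝ) (s : S) : gibbsProb g s ≤ 1 :=
  div_le_one_of_le₀ (Finset.single_le_sum (f := fun r => Real.exp (g r))
    (fun _ _ => (Real.exp_pos _).le) (Finset.mem_univ s))
    (Finset.sum_nonneg fun _ _ => (Real.exp_pos _).le)

theorem sum_exp_pos [Nonempty S] (g : S → ℝ) : 0 < ∑ r, Real.exp (g r) :=
  Finset.sum_pos (fun _ _ => Real.exp_pos _) Finset.univ_nonempty

theorem sum_gibbsProb [Nonempty S] (g : S → ℝ) : ∑ s, gibbsProb g s = 1 := by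
  simp only [gibbsProb, ← Finset.sum_div]
  exact div_self (sum_exp_pos g).ne'

theorem abs_replicaMean_le (n : ℕ) (g : S → ℝ) (f : (Fin n → S) → ℝ) :
    |replicaMean n g f| ≤ ∑ R, |f R| := by
  refine (Finset.abs_sum_le_sum_abs _ _).trans (Finset.sum_le_sum fun R _ => ?_)
  rw [abs_mul, abs_of_nonneg (Finset.prod_nonneg fun a _ => gibbsProb_nonneg g _)]
  exact mul_le_of_le_one_left (abs_nonneg _)
    (Finset.prod_le_one (fun a _ => gibbsProb_nonneg g _) fun a _ => gibbsProb_le_one g _)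

theorem measurable_replicaMean {Ω : Type*} [MeasurableSpace Ω] (n : ℕ) {g : Ω → S → ℝ}
    (hg : ∀ s, Measurable fun ω => g ω s) (f : (Fin n → S) → ℝ) :
    Measurable fun ω => replicaMean n (g ω) f := by
  unfold replicaMean gibbsProb
  fun_prop

theorem replicaMean_comp_perm {n : ℕ} (g : S → ℝ) (f : (Fin n → S) → ℝ)
    (e : Equiv.Perm (Fin n)) :
    replicaMean n g (fun R => f (R ∘ e)) = replicaMean n g f := by
  unfold replicaMean
  rw [← (Equiv.arrowCongr e (Equiv.refl S)).sum_comp]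
  refine Finset.sum_congr rfl fun R _ => ?_
  congr 1
  · exact e.symm.prod_comp fun a => gibbsProb g (R a)
  · simp [Equiv.arrowCongr, Function.comp_def]

theorem replicaMean_sum {κ : Type*} (t : Finset κ) (n : ℕ) (g : S → ℝ) (c : κ → ℝ)
    (f : κ → (Fin n → S) → ℝ) :
    replicaMean n g (fun R => ∑ i ∈ t, c i * f i R) = ∑ i ∈ t, c i * replicaMean n g (f i) := by
  simp only [replicaMean, Finset.mul_sum]
  rw [Finset.sum_comm]
  exact Finset.sum_congr rfl fun i _ => Finset.sum_congr rfl fun R _ => by ring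

theorem replicaMean_add (n : ℕ) (g : S → ℝ) (f₁ f₂ : (Fin n → S) → ℝ) :
    replicaMean n g (fun R => f₁ R + f₂ R) = replicaMean n g f₁ + replicaMean n g f₂ := by
  simp only [replicaMean, mul_add, Finset.sum_add_distrib]

theorem replicaMean_sub (n : ℕ) (g : S → ℝ) (f₁ f₂ : (Fin n → S) → ℝ) :
    replicaMean n g (fun R => f₁ R - f₂ R) = replicaMean n g f₁ - replicaMean n g f₂ := by
  simp only [replicaMean, mul_sub, Finset.sum_sub_distrib]

theorem replicaMean_replicaGrad [Nonempty S] (n : ℕ) (g d : S → ℝ) (f : (Fin n → S) → ℝ) :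
    replicaMean (n + 1) g (replicaGrad n d f)
      = ∑ R : Fin n → S, (∏ a, gibbsProb g (R a)) *
          ((∑ a, (d (R a) - ∑ s, gibbsProb g s * d s)) * f R) := by
  unfold replicaMean replicaGrad
  rw [← (Fin.snocEquiv fun _ => S).sum_comp, Fintype.sum_prod_type_right]
  refine Finset.sum_congr rfl fun R _ => ?_
  simp only [Fin.snocEquiv_apply, Fin.prod_univ_castSucc, Fin.snoc_castSucc, Fin.snoc_last,
    Finset.sum_sub_distrib, Finset.sum_const, Finset.card_univ, Fintype.card_fin, nsmul_eq_mul]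
  have h : ∀ s, (∏ a, gibbsProb g (R a)) * gibbsProb g s * (f R * (∑ a, d (R a) - n * d s))
      = (∏ a, gibbsProb g (R a)) * f R * (∑ a, d (R a)) * gibbsProb g s
        - (∏ a, gibbsProb g (R a)) * f R * n * (gibbsProb g s * d s) := fun s => by ring
  simp only [h, Finset.sum_sub_distrib, ← Finset.mul_sum, sum_gibbsProb]
  ring

theorem hasDerivAt_gibbsProb [Nonempty S] {g : ℝ → S → ℝ} {d : S → ℝ} {u : ℝ}
    (hg : ∀ s, HasDerivAt (fun y => g y s) (d s) u) (s : S) :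
    HasDerivAt (fun y => gibbsProb (g y) s)
      (gibbsProb (g u) s * (d s - ∑ r, gibbsProb (g u) r * d r)) u := by
  have hZ : HasDerivAt (fun y => ∑ r, Real.exp (g y r)) (∑ r, Real.exp (g u r) * d r) u :=
    HasDerivAt.fun_sum fun r _ => (hg r).exp
  refine ((hg s).exp.div hZ (sum_exp_pos _).ne').congr_deriv ?_
  have hpos := (sum_exp_pos (g u)).ne'
  have h : ∑ r, gibbsProb (g u) r * d r
      = (∑ r, Real.exp (g u r) * d r) / ∑ r, Real.exp (g u r) := by
    rw [Finset.sum_div]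
    exact Finset.sum_congr rfl fun r _ => by rw [gibbsProb]; ring
  rw [h, gibbsProb]
  field_simp

theorem hasDerivAt_replicaMean [Nonempty S] (n : ℕ) {g : ℝ → S → ℝ} {d : S → ℝ} {u : ℝ}
    (hg : ∀ s, HasDerivAt (fun y => g y s) (d s) u) (f : (Fin n → S) → ℝ) :
    HasDerivAt (fun y => replicaMean n (g y) f)
      (replicaMean (n + 1) (g u) (replicaGrad n d f)) u := by
  rw [replicaMean_replicaGrad]
  refine HasDerivAt.fun_sum fun R _ => ?_
  refine ((HasDerivAt.fun_finsetProd (u := Finset.univ) fun a _ =>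
    hasDerivAt_gibbsProb hg (R a)).mul_const (f R)).congr_deriv ?_
  rw [← mul_assoc, Finset.mul_sum]
  congr 1
  refine Finset.sum_congr rfl fun a _ => ?_
  rw [smul_eq_mul, ← mul_assoc, Finset.prod_erase_mul _ _ (Finset.mem_univ a)]

theorem replicaMean_const_mul (n : ℕ) (g : S → ℝ) (c : ℝ) (f : (Fin n → S) → ℝ) :
    replicaMean n g (fun R => c * f R) = c * replicaMean n g f := by
  simp only [replicaMean, Finset.mul_sum]
  exact Finset.sum_congr rfl fun R _ => by ring

end ReplicaMean

section Quenched

variable {S ι α : Type*} [Fintype S] [Nonempty S] [Fintype ι] [DecidableEq ι] [MeasurableSpace α]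

/-- Derivative of a quenched replica average in the strength `c` of a linear Gaussian field. -/
theorem hasDerivAt_integral_replicaMean (ν : Measure α) [IsProbabilityMeasure ν]
    {h : α → S → ℝ} (hh : ∀ s, Measurable fun a => h a s) (v : S → ι → ℝ)
    (n : ℕ) (f : (Fin n → S) → ℝ) (c : ℝ) :
    HasDerivAt (fun c => ∫ J, replicaMean n (fun s => h J.1 s + c * ∑ i, J.2 i * v s i) f
        ∂(ν.prod (Measure.pi fun _ : ι => gaussianReal 0 1)))
      (c * ∫ J, replicaMean (n + 2) (fun s => h J.1 s + c * ∑ i, J.2 i * v s i)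
        (fun R => ∑ i, replicaGrad (n + 1) (fun s => v s i) (replicaGrad n (fun s => v s i) f) R)
        ∂(ν.prod (Measure.pi fun _ : ι => gaussianReal 0 1))) c := by
  set P := ν.prod (Measure.pi fun _ : ι => gaussianReal 0 1)
  have hgm : ∀ (c : ℝ) (s : S),
      Measurable fun J : α × (ι → ℝ) => h J.1 s + c * ∑ i, J.2 i * v s i := by
    intro c s
    have : Measurable fun J : α × (ι → ℝ) => h J.1 s := (hh s).comp measurable_fst
    fun_prop
  have hm : ∀ (c : ℝ) (m : ℕ) (f : (Fin m → S) → ℝ), Measurable fun J : α × (ι → ℝ) =>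
      replicaMean m (fun s => h J.1 s + c * ∑ i, J.2 i * v s i) f :=
    fun c m f => measurable_replicaMean m (hgm c) f
  have hint : ∀ (c : ℝ) (m : ℕ) (f : (Fin m → S) → ℝ), Integrable (fun J : α × (ι → ℝ) =>
      replicaMean m (fun s => h J.1 s + c * ∑ i, J.2 i * v s i) f) P :=
    fun c m f => Integrable.of_bound (hm c m f).aestronglyMeasurable _
      (Eventually.of_forall fun J => abs_replicaMean_le m _ f)
  have habs : ∀ i, Integrable (fun J : α × (ι → ℝ) => |J.2 i|) P := fun i =>
    (integrable_abs_eval_pi_gaussianReal i).comp_snd ν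
  have hxint : ∀ (i : ι) (m : ℕ) (f : (Fin m → S) → ℝ), Integrable (fun J : α × (ι → ℝ) =>
      J.2 i * replicaMean m (fun s => h J.1 s + c * ∑ i, J.2 i * v s i) f) P := by
    intro i m f
    refine ((habs i).mul_const (∑ R, |f R|)).mono' ?_ (Eventually.of_forall fun J => ?_)
    · exact (((measurable_pi_apply i).comp measurable_snd).mul (hm c m f)).aestronglyMeasurable
    · rw [Real.norm_eq_abs, abs_mul]
      exact mul_le_mul_of_nonneg_left (abs_replicaMean_le m _ f) (abs_nonneg _)
  have hsplit : ∀ (c : ℝ) (J : α × (ι → ℝ)),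
      replicaMean (n + 1) (fun s => h J.1 s + c * ∑ i, J.2 i * v s i)
          (replicaGrad n (fun s => ∑ i, J.2 i * v s i) f)
        = ∑ i, J.2 i * replicaMean (n + 1) (fun s => h J.1 s + c * ∑ i, J.2 i * v s i)
          (replicaGrad n (fun s => v s i) f) := by
    intro c J
    rw [replicaGrad_sum, replicaMean_sum]
  have hstein : ∀ i, ∫ J : α × (ι → ℝ),
      J.2 i * replicaMean (n + 1) (fun s => h J.1 s + c * ∑ i, J.2 i * v s i)
        (replicaGrad n (fun s => v s i) f) ∂P
      = ∫ J : α × (ι → ℝ), c * replicaMean (n + 2) (fun s => h J.1 s + c * ∑ i, J.2 i * v s i)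
        (replicaGrad (n + 1) (fun s => v s i) (replicaGrad n (fun s => v s i) f)) ∂P := by
    intro i
    rw [integral_prod _ (hxint i _ _), integral_prod _ ((hint c _ _).const_mul c)]
    refine integral_congr_ae (Eventually.of_forall fun a => ?_)
    have hma : ∀ (m : ℕ) (f : (Fin m → S) → ℝ), Measurable fun x : ι → ℝ =>
        replicaMean m (fun s => h a s + c * ∑ i, x i * v s i) f :=
      fun m f => measurable_replicaMean m (fun s => by fun_prop) f
    have hbound : ∀ (m : ℕ) (f : (Fin m → S) → ℝ) (x : ι → ℝ),
        |replicaMean m (fun s => h a s + c * ∑ i, x i * v s i) f| ≤ ∑ R, |f R| :=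
      fun m f x => abs_replicaMean_le m _ f
    refine integral_eval_mul_pi_gaussianReal i (hma _ (replicaGrad n (fun s => v s i) f))
      ((hma _ (replicaGrad (n + 1) (fun s => v s i) (replicaGrad n (fun s => v s i) f))).const_mul c)
      (fun x y => ?_) (hbound _ _)
      (fun x => (abs_mul c _).trans_le (mul_le_mul_of_nonneg_left (hbound _ _ x) (abs_nonneg c)))
    have hd : ∀ s, HasDerivAt
        (fun y => h a s + c * ∑ j, Function.update x i y j * v s j) (c * v s i) y := by
      intro s
      have hs : HasDerivAt (fun y => ∑ j, Function.update x i y j * v s j) (v s i) y := by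
        have := HasDerivAt.fun_sum (u := Finset.univ) fun j (_ : j ∈ Finset.univ) =>
          (((hasDerivAt_pi.1 (hasDerivAt_update x i y)) j).mul_const (v s j))
        simpa [Pi.single_apply] using this
      exact (hs.const_mul c).const_add _
    refine (hasDerivAt_replicaMean (n + 1) hd _).congr_deriv ?_
    rw [replicaGrad_const_mul, replicaMean_const_mul]
  have hmain := hasDerivAt_integral_of_dominated_loc_of_deriv_le (μ := P) (x₀ := c)
    (s := Set.univ) (F := fun c J => replicaMean n (fun s => h J.1 s + c * ∑ i, J.2 i * v s i) f)
    (F' := fun c J => ∑ i, J.2 i * replicaMean (n + 1)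
      (fun s => h J.1 s + c * ∑ i, J.2 i * v s i) (replicaGrad n (fun s => v s i) f))
    (bound := fun J => ∑ i, |J.2 i| * ∑ R, |replicaGrad n (fun s => v s i) f R|)
    Filter.univ_mem (Eventually.of_forall fun c => (hm c n f).aestronglyMeasurable)
    (hint c n f) (integrable_finsetSum _ fun i _ => hxint i _ _).aestronglyMeasurable
    (Eventually.of_forall fun J c _ => by
      refine (Finset.abs_sum_le_sum_abs _ _).trans (Finset.sum_le_sum fun i _ => ?_)
      rw [abs_mul]
      exact mul_le_mul_of_nonneg_left (abs_replicaMean_le _ _ _) (abs_nonneg _))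
    (integrable_finsetSum _ fun i _ => (habs i).mul_const _)
    (Eventually.of_forall fun J c _ => by
      rw [← hsplit]
      refine hasDerivAt_replicaMean n (fun s => ?_) f
      simpa using ((hasDerivAt_id c).mul_const (∑ i, J.2 i * v s i)).const_add (h J.1 s))
  refine hmain.2.congr_deriv ?_
  rw [integral_finsetSum _ fun i _ => hxint i _ _]
  simp_rw [hstein, integral_const_mul, ← Finset.mul_sum]
  rw [← integral_finsetSum _ fun i _ => hint c _ _]
  congr 2
  ext J
  simpa using (replicaMean_sum Finset.univ (n + 2) (fun s => h J.1 s + c * ∑ i, J.2 i * v s i)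
    (fun _ => 1) fun i => replicaGrad (n + 1) (fun s => v s i)
      (replicaGrad n (fun s => v s i) f)).symm

end Quenched

section Cavity

variable {N M : ℕ}

theorem spinval_mul_self (b : Bool) : spinval b * spinval b = 1 := by
  cases b <;> simp [spinval]

theorem ovlp_comm (σ σ' : Fin N → Bool) : ovlp N σ σ' = ovlp N σ' σ := by
  simp only [ovlp, mul_comm]

theorem ovlp_self (hN : 1 ≤ N) (σ : Fin N → Bool) : ovlp N σ σ = 1 := by
  have : (N : ℝ) ≠ 0 := by positivity
  simp [ovlp, spinval_mul_self, this]

/-- Coefficient of the coupling `J̃_{ik}` in the cavity interaction. -/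
def cavityField (s : (Fin N → Bool) × (Fin M → Bool)) (p : Fin N × Fin M) : ℝ :=
  spinval (s.2 p.2) * spinval (s.1 p.1)

/-- Product of the two overlaps of a pair of configurations. -/
def ovlpProd (s r : (Fin N → Bool) × (Fin M → Bool)) : ℝ :=
  ovlp N s.1 r.1 * ovlp M s.2 r.2

theorem ovlpProd_comm (s r : (Fin N → Bool) × (Fin M → Bool)) : ovlpProd s r = ovlpProd r s := by
  simp only [ovlpProd, ovlp_comm]

theorem ovlpProd_self (hN : 1 ≤ N) (hM : 1 ≤ M) (s : (Fin N → Bool) × (Fin M → Bool)) :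
    ovlpProd s s = 1 := by
  simp [ovlpProd, ovlp_self hN, ovlp_self hM]

theorem sum_cavityField_mul (hN : 1 ≤ N) (hM : 1 ≤ M) (s r : (Fin N → Bool) × (Fin M → Bool)) :
    ∑ p, cavityField s p * cavityField r p = (N * M : ℝ) * ovlpProd s r := by
  have hN' : (N : ℝ) ≠ 0 := by positivity
  have hM' : (M : ℝ) ≠ 0 := by positivity
  have h : (N * M : ℝ) * ovlpProd s r = (∑ i, spinval (s.1 i) * spinval (r.1 i))
      * ∑ k, spinval (s.2 k) * spinval (r.2 k) := by
    simp only [ovlpProd, ovlp]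
    field_simp
  rw [h, Fintype.sum_mul_sum, Fintype.sum_prod_type]
  exact Finset.sum_congr rfl fun i _ => Finset.sum_congr rfl fun k _ => by
    simp only [cavityField]; ring

/-- Logarithm of the weight `ξ_τ`. -/
def logTilt (N M : ℕ) (β : ℝ) (J : Fin M × Fin M → ℝ) (s : (Fin N → Bool) × (Fin M → Bool)) : ℝ :=
  (β / Real.sqrt M) * ∑ k : Fin M, ∑ l : Fin M, J (k, l) * spinval (s.2 k) * spinval (s.2 l)

theorem replicaAvg_eq_integral_replicaMean (n : ℕ) (β t : ℝ)
    (f : (Fin n → (Fin N → Bool) × (Fin M → Bool)) → ℝ) :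
    replicaAvg n N M β t f = ∫ J, replicaMean n (fun s => logTilt N M β J.1 s
      + Real.sqrt (t / ((N : ℝ) * (M : ℝ))) * ∑ p, J.2 p * cavityField s p) f
      ∂(couplingLaw N M) := by
  unfold replicaAvg
  congr 1
  ext J
  have h : ∀ s, cavityWeight N M β t J s = Real.exp (logTilt N M β J.1 s
      + Real.sqrt (t / ((N : ℝ) * (M : ℝ))) * ∑ p, J.2 p * cavityField s p) := by
    intro s
    simp only [cavityWeight, logTilt, cavityField, Fintype.sum_prod_type, mul_assoc]
  simp only [replicaMean, gibbsProb, cavityZ, h, Finset.prod_div_distrib, Finset.prod_const,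
    Finset.card_univ, Fintype.card_fin, Finset.sum_div]
  exact Finset.sum_congr rfl fun R _ => by ring

/-- The doubly differentiated observable, expressed through overlap products. -/
theorem sum_replicaGrad_replicaGrad_cavityField (hN : 1 ≤ N) (hM : 1 ≤ M)
    (R : Fin 4 → (Fin N → Bool) × (Fin M → Bool)) :
    ∑ p, replicaGrad 3 (fun s => cavityField s p)
        (replicaGrad 2 (fun s => cavityField s p) fun R => ovlpProd (R 0) (R 1)) R
      = (N * M : ℝ) * (2 * (ovlpProd (R 0) (R 1) * ovlpProd (R 0) (R 1))
        - ovlpProd (R 0) (R 1) * ovlpProd (R 0) (R 2)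
        - ovlpProd (R 0) (R 1) * ovlpProd (R 1) (R 2)
        - 3 * (ovlpProd (R 0) (R 1) * ovlpProd (R 0) (R 3))
        - 3 * (ovlpProd (R 0) (R 1) * ovlpProd (R 1) (R 3))
        + 6 * (ovlpProd (R 0) (R 1) * ovlpProd (R 2) (R 3))) := by
  have e : ∀ p, replicaGrad 3 (fun s => cavityField s p)
        (replicaGrad 2 (fun s => cavityField s p) fun R => ovlpProd (R 0) (R 1)) R
      = ovlpProd (R 0) (R 1) * (cavityField (R 0) p * cavityField (R 0) p
        + cavityField (R 1) p * cavityField (R 1) p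
        - 2 * (cavityField (R 2) p * cavityField (R 2) p)
        + 2 * (cavityField (R 0) p * cavityField (R 1) p)
        - cavityField (R 0) p * cavityField (R 2) p
        - cavityField (R 1) p * cavityField (R 2) p
        - 3 * (cavityField (R 0) p * cavityField (R 3) p)
        - 3 * (cavityField (R 1) p * cavityField (R 3) p)
        + 6 * (cavityField (R 2) p * cavityField (R 3) p)) := by
    intro p
    have h0 : (Fin.castSucc (Fin.castSucc (0 : Fin 2))) = (0 : Fin 4) := rfl
    have h1 : (Fin.castSucc (Fin.castSucc (1 : Fin 2))) = (1 : Fin 4) := rfl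
    have h2 : Fin.castSucc (Fin.last 2) = (2 : Fin 4) := rfl
    have h2' : Fin.castSucc (2 : Fin 3) = (2 : Fin 4) := rfl
    have h1' : Fin.castSucc (1 : Fin 3) = (1 : Fin 4) := rfl
    have h0' : Fin.castSucc (0 : Fin 3) = (0 : Fin 4) := rfl
    have h3 : Fin.last 3 = (3 : Fin 4) := rfl
    simp only [replicaGrad, Fin.sum_univ_two, Fin.sum_univ_three, h0, h1, h2, h0', h1', h2', h3]
    push_cast
    ring
  simp only [e, ← Finset.mul_sum, Finset.sum_add_distrib, Finset.sum_sub_distrib,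
    sum_cavityField_mul hN hM, ovlpProd_self hN hM]
  ring

theorem replicaMean_sum_replicaGrad_cavityField (hN : 1 ≤ N) (hM : 1 ≤ M)
    (g : (Fin N → Bool) × (Fin M → Bool) → ℝ) :
    replicaMean 4 g (fun R => ∑ p, replicaGrad 3 (fun s => cavityField s p)
        (replicaGrad 2 (fun s => cavityField s p) fun R => ovlpProd (R 0) (R 1)) R)
      = (2 * (N * M) : ℝ) * replicaMean 4 g (fun R =>
        ovlpProd (R 0) (R 1) * ovlpProd (R 0) (R 1)
        - 4 * (ovlpProd (R 0) (R 1) * ovlpProd (R 1) (R 2))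
        + 3 * (ovlpProd (R 0) (R 1) * ovlpProd (R 2) (R 3))) := by
  have h02 : replicaMean 4 g (fun R => ovlpProd (R 0) (R 1) * ovlpProd (R 0) (R 2))
      = replicaMean 4 g (fun R => ovlpProd (R 0) (R 1) * ovlpProd (R 1) (R 2)) := by
    rw [← replicaMean_comp_perm g _ (Equiv.swap 0 1)]
    simp [ovlpProd_comm, Equiv.swap_apply_of_ne_of_ne]
  have h13 : replicaMean 4 g (fun R => ovlpProd (R 0) (R 1) * ovlpProd (R 1) (R 3))
      = replicaMean 4 g (fun R => ovlpProd (R 0) (R 1) * ovlpProd (R 1) (R 2)) := by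
    rw [← replicaMean_comp_perm g _ (Equiv.swap 2 3)]
    simp [Equiv.swap_apply_of_ne_of_ne]
  have h03 : replicaMean 4 g (fun R => ovlpProd (R 0) (R 1) * ovlpProd (R 0) (R 3))
      = replicaMean 4 g (fun R => ovlpProd (R 0) (R 1) * ovlpProd (R 0) (R 2)) := by
    rw [← replicaMean_comp_perm g _ (Equiv.swap 2 3)]
    simp [Equiv.swap_apply_of_ne_of_ne]
  simp only [sum_replicaGrad_replicaGrad_cavityField hN hM]
  simp only [replicaMean_const_mul, replicaMean_add, replicaMean_sub, h03, h02, h13]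
  ring

end Cavity

/-- `d/dt ⟨q₁₂q̃₁₂⟩_t = ⟨q₁₂²q̃₁₂² − 4 q₁₂q̃₁₂q₂₃q̃₂₃ + 3 q₁₂q̃₁₂q₃₄q̃₃₄⟩_t` for `t > 0`. -/
theorem streaming_q12 (N M : ℕ) (hN : 1 ≤ N) (hM : 1 ≤ M)
    (β : ℝ) (hβ : 0 ≤ β) (t : ℝ) (ht : 0 < t) :
    HasDerivAt
      (fun t' => replicaAvg 2 N M β t' (fun R =>
        ovlp N (R 0).1 (R 1).1 * ovlp M (R 0).2 (R 1).2))
      (replicaAvg 4 N M β t (fun R =>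
        (ovlp N (R 0).1 (R 1).1) ^ 2 * (ovlp M (R 0).2 (R 1).2) ^ 2
        - 4 * (ovlp N (R 0).1 (R 1).1 * ovlp M (R 0).2 (R 1).2 *
            ovlp N (R 1).1 (R 2).1 * ovlp M (R 1).2 (R 2).2)
        + 3 * (ovlp N (R 0).1 (R 1).1 * ovlp M (R 0).2 (R 1).2 *
            ovlp N (R 2).1 (R 3).1 * ovlp M (R 2).2 (R 3).2)))
      t := by
  have hN' : (0 : ℝ) < N := by positivity
  have hM' : (0 : ℝ) < M := by positivity
  have hh : ∀ s : (Fin N → Bool) × (Fin M → Bool), Measurable fun J => logTilt N M β J s := by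
    intro s
    unfold logTilt
    fun_prop
  have hderiv := (hasDerivAt_integral_replicaMean
    (Measure.pi fun _ : Fin M × Fin M => gaussianReal 0 1) hh cavityField 2
    (fun R => ovlpProd (R 0) (R 1)) (Real.sqrt (t / ((N : ℝ) * (M : ℝ))))).comp t
    (((hasDerivAt_id t).div_const ((N : ℝ) * M)).sqrt (div_pos ht (mul_pos hN' hM')).ne')
  simp only [replicaAvg_eq_integral_replicaMean]
  refine hderiv.congr_deriv ?_
  simp only [Nat.reduceAdd, replicaMean_sum_replicaGrad_cavityField hN hM, integral_const_mul, id]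
  have hpos : 0 < Real.sqrt (t / ((N : ℝ) * M)) := Real.sqrt_pos.2 (by positivity)
  have hobs : (fun R : Fin 4 → (Fin N → Bool) × (Fin M → Bool) =>
        (ovlp N (R 0).1 (R 1).1) ^ 2 * (ovlp M (R 0).2 (R 1).2) ^ 2
        - 4 * (ovlp N (R 0).1 (R 1).1 * ovlp M (R 0).2 (R 1).2 *
            ovlp N (R 1).1 (R 2).1 * ovlp M (R 1).2 (R 2).2)
        + 3 * (ovlp N (R 0).1 (R 1).1 * ovlp M (R 0).2 (R 1).2 *
            ovlp N (R 2).1 (R 3).1 * ovlp M (R 2).2 (R 3).2))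
      = fun R => ovlpProd (R 0) (R 1) * ovlpProd (R 0) (R 1)
        - 4 * (ovlpProd (R 0) (R 1) * ovlpProd (R 1) (R 2))
        + 3 * (ovlpProd (R 0) (R 1) * ovlpProd (R 2) (R 3)) := by
    ext R
    simp only [ovlpProd]
    ring
  rw [hobs, couplingLaw]
  field_simp
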